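/- Every kG-module homomorphism from V₋ to the trivial one-dimensional module k_tr is zero, and every kG-module homomorphism from V₋ to the Steinberg module St is zero; i.e., Hom_{kG}(V₋, k_tr) = 0 and Hom_{kG}(V₋, St) = 0. -/

import Mathlib

noncomputable section

open scoped TensorProduct

namespace SL2X

variable (p : ℕ) [Fact p.Prime]

/-- The algebraic closure of the prime field `𝔽_p`. -/
abbrev F : Type := AlgebraicClosure (ZMod p)

/-- `G = SL₂(F)`. -/
abbrev G : Type := Matrix.SpecialLinearGroup (Fin 2) (F p)

/-- The unipotent element `ε(x) = [[1,x],[0,1]]`. -/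
def eps (x : F p) : G p :=
  ⟨!![1, x; 0, 1], by simp [Matrix.det_fin_two_of]⟩

/-- The torus element `h(t) = diag(t, t⁻¹)`. -/
def h (t : (F p)ˣ) : G p :=
  ⟨!![(t : F p), 0; 0, ((t⁻¹ : (F p)ˣ) : F p)], by simp [Matrix.det_fin_two_of]⟩

/-- The Weyl element `s = [[0,1],[-1,0]]`. -/
def sG : G p :=
  ⟨!![0, 1; -1, 0], by simp [Matrix.det_fin_two_of]⟩

/-- The Borel subgroup `B` of upper triangular matrices in `G`. -/
def B : Subgroup (G p) where
  carrier := {g | (g : Matrix (Fin 2) (Fin 2) (F p)) 1 0 = 0}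
  one_mem' := by simp [Matrix.one_apply]
  mul_mem' := by
    intro a b ha hb
    simp only [Set.mem_setOf_eq] at *
    simp [Matrix.mul_apply, Fin.sum_univ_two, ha, hb]
  inv_mem' := by
    intro a ha
    simp only [Set.mem_setOf_eq] at *
    simp [Matrix.SpecialLinearGroup.coe_inv, Matrix.adjugate_fin_two, ha]

/-- The diagonal part of an element of `B`, as a unit of `F`. -/
def Bdiag (b : B p) : (F p)ˣ where
  val := ((b : G p) : Matrix (Fin 2) (Fin 2) (F p)) 0 0
  inv := ((b : G p) : Matrix (Fin 2) (Fin 2) (F p)) 1 1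
  val_inv := by
    have hdet : ((b : G p) : Matrix (Fin 2) (Fin 2) (F p)).det = 1 := (b : G p).2
    have h10 : ((b : G p) : Matrix (Fin 2) (Fin 2) (F p)) 1 0 = 0 := b.2
    rw [Matrix.det_fin_two, h10, mul_zero, sub_zero] at hdet
    exact hdet
  inv_val := by
    have hdet : ((b : G p) : Matrix (Fin 2) (Fin 2) (F p)).det = 1 := (b : G p).2
    have h10 : ((b : G p) : Matrix (Fin 2) (Fin 2) (F p)) 1 0 = 0 := b.2
    rw [Matrix.det_fin_two, h10, mul_zero, sub_zero] at hdet
    rw [mul_comm]; exact hdet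

variable (k : Type) [Field k] [IsAlgClosed k] [CharZero k]

/-- The group algebra `kG`. -/
abbrev kG : Type := MonoidAlgebra k (G p)

/-- The canonical image of a group element in the group algebra. -/
def γ (g : G p) : kG p k := MonoidAlgebra.of k (G p) g

/-- The submodule of relations defining the induced module
`M(θ) = kG ⊗_{kB} k_θ`, where the character `θ` of `T ≅ Fˣ` is extended to `B`
by letting `U` act trivially. -/
def Nmod (θ : (F p)ˣ →* kˣ) : Submodule (kG p k) (kG p k) :=
  Submodule.span (kG p k)
    {y | ∃ b : B p, y = γ p k (b : G p) - ((θ (Bdiag p b) : k)) • (1 : kG p k)}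

/-- The induced module `M(θ) = kG ⊗_{kB} k_θ`, realized as `kG / N(θ)` where
`N(θ)` is the left submodule generated by the elements `b - θ(b)·1`, `b ∈ B`. -/
def Mmod (θ : (F p)ˣ →* kˣ) : Type := kG p k ⧸ Nmod p k θ

instance (θ : (F p)ˣ →* kˣ) : AddCommGroup (Mmod p k θ) :=
  inferInstanceAs (AddCommGroup (kG p k ⧸ Nmod p k θ))
instance (θ : (F p)ˣ →* kˣ) : Module (kG p k) (Mmod p k θ) :=
  inferInstanceAs (Module (kG p k) (kG p k ⧸ Nmod p k θ))
instance (θ : (F p)ˣ →* kˣ) : Module k (Mmod p k θ) :=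
  inferInstanceAs (Module k (kG p k ⧸ Nmod p k θ))
instance (θ : (F p)ˣ →* kˣ) : IsScalarTower k (kG p k) (Mmod p k θ) :=
  inferInstanceAs (IsScalarTower k (kG p k) (kG p k ⧸ Nmod p k θ))

/-- The canonical generator `1_θ ∈ M(θ)`. -/
def oneθ (θ : (F p)ˣ →* kˣ) : Mmod p k θ :=
  Submodule.Quotient.mk (1 : kG p k)

/-- `η = (1 - s)·1_tr ∈ M(tr)`. -/
def eta : Mmod p k 1 :=
  Submodule.Quotient.mk ((1 : kG p k) - γ p k (sG p))

/-- The Steinberg module `St = kG·η ⊆ M(tr)`. -/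
def St : Submodule (kG p k) (Mmod p k 1) :=
  Submodule.span (kG p k) {eta p k}

/-- `ε(x)·η` as an element of `St`. -/
def E (x : F p) : ↥(St p k) :=
  ⟨γ p k (eps p x) • eta p k,
    Submodule.smul_mem _ _ (Submodule.mem_span_singleton_self _)⟩

/-- The action of a group element on `St`, as a `k`-linear map. -/
def gSt (g : G p) : ↥(St p k) →ₗ[k] ↥(St p k) where
  toFun v := ⟨γ p k g • (v : Mmod p k 1), Submodule.smul_mem _ _ v.2⟩
  map_add' := by intro a b; apply Subtype.ext; simp [smul_add]
  map_smul' := by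
    intro c v; apply Subtype.ext
    simp [smul_comm (γ p k g) c]

/-- `St ⊗_k St`. -/
abbrev StT : Type := ↥(St p k) ⊗[k] ↥(St p k)

/-- The diagonal action of a group element on `St ⊗_k St`. -/
def gTT (g : G p) : StT p k →ₗ[k] StT p k :=
  TensorProduct.map (gSt p k g) (gSt p k g)

/-- `ω_{x,y} = (ε(x)η ⊗ ε(y)η + ε(y)η ⊗ ε(x)η)/2`. -/
def ω (x y : F p) : StT p k :=
  (2 : k)⁻¹ • (E p k x ⊗ₜ[k] E p k y + E p k y ⊗ₜ[k] E p k x)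

/-- `ρ_{x,y} = (ε(x)η ⊗ ε(y)η − ε(y)η ⊗ ε(x)η)/2`. -/
def ρ (x y : F p) : StT p k :=
  (2 : k)⁻¹ • (E p k x ⊗ₜ[k] E p k y - E p k y ⊗ₜ[k] E p k x)

/-- `V₊`, the span of the `ω_{x,y}`. -/
def Vplus : Submodule k (StT p k) :=
  Submodule.span k {v | ∃ x y : F p, v = ω p k x y}

/-- `V₋`, the span of the `ρ_{x,y}` for `x ≠ y`. -/
def Vminus : Submodule k (StT p k) :=
  Submodule.span k {v | ∃ x y : F p, x ≠ y ∧ v = ρ p k x y}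


variable {p k}

theorem γ_mul (g g' : G p) : γ p k (g * g') = γ p k g * γ p k g' :=
  map_mul (MonoidAlgebra.of k (G p)) g g'

theorem eps_mul_eps (x y : F p) : eps p x * eps p y = eps p (x + y) := by
  apply Subtype.ext
  simp only [Matrix.SpecialLinearGroup.coe_mul]
  simp [eps, add_comm]

theorem h_mul_eps (t : (F p)ˣ) (x : F p) :
    h p t * eps p x = eps p ((t : F p) ^ 2 * x) * h p t := by
  apply Subtype.ext
  simp only [Matrix.SpecialLinearGroup.coe_mul]
  simp [eps, h]
  field_simp

theorem h_mul_sG (t : (F p)ˣ) : h p t * sG p = sG p * h p t⁻¹ := by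
  apply Subtype.ext
  simp only [Matrix.SpecialLinearGroup.coe_mul]
  simp [sG, h]

theorem h_mem_B (t : (F p)ˣ) : h p t ∈ B p := by
  change (h p t : Matrix (Fin 2) (Fin 2) (F p)) 1 0 = 0
  simp [h]

theorem eps_mem_B (x : F p) : eps p x ∈ B p := by
  change (eps p x : Matrix (Fin 2) (Fin 2) (F p)) 1 0 = 0
  simp [eps]

theorem γ_smul_oneθ {b : G p} (hb : b ∈ B p) : γ p k b • oneθ p k 1 = oneθ p k 1 := by
  refine (Submodule.Quotient.eq (Nmod p k 1)).2 (Submodule.subset_span ⟨⟨b, hb⟩, ?_⟩)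
  simp

theorem eta_eq : eta p k = oneθ p k 1 - γ p k (sG p) • oneθ p k 1 := by
  change Submodule.Quotient.mk _ = Submodule.Quotient.mk (1 - γ p k (sG p) * 1)
  rw [mul_one]

theorem γ_h_smul_eta (t : (F p)ˣ) : γ p k (h p t) • eta p k = eta p k := by
  rw [eta_eq, smul_sub, smul_smul, ← γ_mul, h_mul_sG, γ_mul, mul_smul,
    γ_smul_oneθ (h_mem_B t), γ_smul_oneθ (h_mem_B t⁻¹)]

/-- The Borel subgroup permutes the vectors `ε(x)η` by affine transformations of `x`. -/
theorem gSt_affine_E (a : F p) (t : (F p)ˣ) (x : F p) :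
    gSt p k (eps p a * h p t) (E p k x) = E p k (a + (t : F p) ^ 2 * x) := by
  apply Subtype.ext
  change γ p k (eps p a * h p t) • γ p k (eps p x) • eta p k = γ p k (eps p _) • eta p k
  rw [smul_smul, ← γ_mul, mul_assoc, h_mul_eps, ← mul_assoc, eps_mul_eps, γ_mul, mul_smul,
    γ_h_smul_eta]

theorem ρ_add_swap (x y : F p) : ρ p k x y + ρ p k y x = 0 := by
  refine (smul_add (2 : k)⁻¹ _ _).symm.trans ?_
  refine (congrArg (fun v : StT p k => (2 : k)⁻¹ • v) ?_).trans (smul_zero _)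
  exact (sub_add_sub_cancel _ _ _).trans (sub_self _)

theorem gTT_affine_ρ (a : F p) (t : (F p)ˣ) (x y : F p) :
    gTT p k (eps p a * h p t) (ρ p k x y) =
      ρ p k (a + (t : F p) ^ 2 * x) (a + (t : F p) ^ 2 * y) := by
  simp only [ρ, gTT, map_smul, map_sub, TensorProduct.map_tmul, gSt_affine_E]

/-- Any two points of the affine line are exchanged by an element of the Borel subgroup. -/
theorem exists_mem_B_gTT_ρ_eq_swap (x y : F p) :
    ∃ b ∈ B p, gTT p k b (ρ p k x y) = ρ p k y x := by
  obtain ⟨i, hi⟩ := IsAlgClosed.exists_pow_nat_eq (-1 : F p) (n := 2) two_pos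
  have hi0 : i ≠ 0 := by rintro rfl; simp at hi
  refine ⟨eps p (x + y) * h p (Units.mk0 i hi0), mul_mem (eps_mem_B _) (h_mem_B _), ?_⟩
  rw [gTT_affine_ρ, Units.val_mk0, hi]
  congr 1 <;> ring

theorem eq_zero_of_B_invariant
    (hstab : ∀ (g : G p) (v : StT p k), v ∈ Vminus p k → gTT p k g v ∈ Vminus p k)
    (φ : ↥(Vminus p k) →ₗ[k] k)
    (hφ : ∀ b ∈ B p, ∀ v : ↥(Vminus p k),
      φ ⟨gTT p k b (v : StT p k), hstab b v v.2⟩ = φ v) : φ = 0 := by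
  ext ⟨v, hv⟩
  change φ ⟨v, hv⟩ = 0
  induction hv using Submodule.span_induction with
  | mem v hv =>
    obtain ⟨x, y, hxy, rfl⟩ := hv
    obtain ⟨b, hb, hbρ⟩ := exists_mem_B_gTT_ρ_eq_swap (k := k) x y
    have hmem : ρ p k x y ∈ Vminus p k := Submodule.subset_span ⟨x, y, hxy, rfl⟩
    have hmem' : ρ p k y x ∈ Vminus p k := Submodule.subset_span ⟨y, x, hxy.symm, rfl⟩
    have hswap : φ ⟨ρ p k y x, hmem'⟩ = φ ⟨ρ p k x y, hmem⟩ := by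
      rw [← hφ b hb ⟨ρ p k x y, hmem⟩]
      exact congrArg φ (Subtype.ext hbρ.symm)
    have hadd : φ ⟨ρ p k x y, hmem⟩ + φ ⟨ρ p k y x, hmem'⟩ = 0 := by
      rw [← map_add, ← map_zero φ]
      exact congrArg φ (Subtype.ext (ρ_add_swap x y))
    rwa [hswap, add_self_eq_zero] at hadd
  | zero => exact map_zero φ
  | add v w hv hw ihv ihw =>
    exact (map_add φ ⟨v, hv⟩ ⟨w, hw⟩).trans (by rw [ihv, ihw, add_zero])
  | smul c v hv ih =>
    exact (map_smul φ c ⟨v, hv⟩).trans (by rw [ih, smul_zero])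

variable (p k) in
/-- The linear extension `kG → k[G/B]` of the projection `G → G/B`. -/
def toCosets : kG p k →ₗ[k] (G p ⧸ B p →₀ k) :=
  Finsupp.lmapDomain k k (QuotientGroup.mk : G p → G p ⧸ B p) ∘ₗ
    (MonoidAlgebra.coeffLinearEquiv k).toLinearMap

theorem toCosets_γ (g : G p) :
    toCosets p k (γ p k g) = Finsupp.single (QuotientGroup.mk g) 1 := by
  simp [toCosets, γ]

theorem linearMap_ext_γ {V : Type*} [AddCommMonoid V] [Module k V] {f f' : kG p k →ₗ[k] V}
    (hff : ∀ g, f (γ p k g) = f' (γ p k g)) : f = f' :=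
  MonoidAlgebra.lhom_ext' fun g => LinearMap.ext_ring (hff g)

theorem toCosets_γ_mul (g : G p) (a : kG p k) :
    toCosets p k (γ p k g * a) =
      Finsupp.lmapDomain k k (fun c : G p ⧸ B p => g • c) (toCosets p k a) := by
  refine LinearMap.congr_fun (f := toCosets p k ∘ₗ LinearMap.mulLeft k (γ p k g))
    (g := Finsupp.lmapDomain k k (fun c : G p ⧸ B p => g • c) ∘ₗ toCosets p k)
    (linearMap_ext_γ fun g' => ?_) a
  simp [← γ_mul, toCosets_γ]

theorem toCosets_eq_zero {a : kG p k} (ha : a ∈ Nmod p k 1) : toCosets p k a = 0 := by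
  induction ha using Submodule.span_induction with
  | mem a ha =>
    obtain ⟨b, rfl⟩ := ha
    have hone : (1 : kG p k) = γ p k 1 := (map_one (MonoidAlgebra.of k (G p))).symm
    have hb : (QuotientGroup.mk (b : G p) : G p ⧸ B p) = QuotientGroup.mk 1 :=
      QuotientGroup.eq.2 (by simp)
    rw [hone, map_sub, map_smul, toCosets_γ, toCosets_γ, hb]
    simp
  | zero => exact map_zero _
  | add a a' _ _ ih ih' => rw [map_add, ih, ih', add_zero]
  | smul c a _ ih =>
    refine LinearMap.congr_fun (f := toCosets p k ∘ₗ LinearMap.mulRight k a) (g := 0)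
      (linearMap_ext_γ fun g => ?_) c
    simp [toCosets_γ_mul, ih]

variable (p k) in
/-- The identification of `M(tr)` with `k[G/B]`, as a linear map. -/
def Mmod.toCosets : Mmod p k 1 →ₗ[k] (G p ⧸ B p →₀ k) :=
  ((Nmod p k 1).restrictScalars k).liftQ (SL2X.toCosets p k) fun _ ha => toCosets_eq_zero ha

theorem Mmod.toCosets_γ_smul (g : G p) (m : Mmod p k 1) :
    Mmod.toCosets p k (γ p k g • m) =
      Finsupp.lmapDomain k k (fun c : G p ⧸ B p => g • c) (Mmod.toCosets p k m) := by
  obtain ⟨a, rfl⟩ := Submodule.Quotient.mk_surjective (Nmod p k 1) m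
  exact toCosets_γ_mul g a

theorem Mmod.toCosets_γ_smul_apply (g : G p) (m : Mmod p k 1) (c : G p ⧸ B p) :
    Mmod.toCosets p k (γ p k g • m) (g • c) = Mmod.toCosets p k m c := by
  rw [Mmod.toCosets_γ_smul]
  exact Finsupp.mapDomain_apply (MulAction.injective g) _ _

theorem mk_γ_out (g : G p) :
    (Submodule.Quotient.mk (γ p k (QuotientGroup.mk g : G p ⧸ B p).out) : kG p k ⧸ Nmod p k 1) =
      Submodule.Quotient.mk (γ p k g) := by
  obtain ⟨b, hb⟩ := QuotientGroup.mk_out_eq_mul (B p) g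
  have hsmul (x : G p) :
      (Submodule.Quotient.mk (γ p k x) : Mmod p k 1) = γ p k x • oneθ p k 1 := by
    change _ = Submodule.Quotient.mk (γ p k x * 1)
    rw [mul_one]
  refine (hsmul _).trans (Eq.trans ?_ (hsmul _).symm)
  rw [hb, γ_mul, mul_smul, γ_smul_oneθ b.2]

theorem Mmod.toCosets_injective : Function.Injective (Mmod.toCosets p k) := by
  let r : (G p ⧸ B p →₀ k) →ₗ[k] (kG p k ⧸ Nmod p k 1) :=
    Finsupp.linearCombination k fun c => Submodule.Quotient.mk (γ p k c.out)
  refine Function.LeftInverse.injective (g := r) fun m => ?_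
  obtain ⟨a, rfl⟩ := Submodule.Quotient.mk_surjective (Nmod p k 1) m
  refine LinearMap.congr_fun (f := r ∘ₗ SL2X.toCosets p k)
    (g := (Nmod p k 1).mkQ.restrictScalars k) (linearMap_ext_γ fun g => ?_) a
  simp [r, toCosets_γ, mk_γ_out]

variable (p k)

/-- `Hom_{kG}(V₋, k_tr) = 0` and `Hom_{kG}(V₋, St) = 0`. -/
theorem stmt15 (hp2 : p ≠ 2)
    (hstab : ∀ (g : G p) (v : StT p k), v ∈ Vminus p k → gTT p k g v ∈ Vminus p k) :
    (∀ φ : ↥(Vminus p k) →ₗ[k] k,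
      (∀ (g : G p) (v : ↥(Vminus p k)),
        φ ⟨gTT p k g (v : StT p k), hstab g v v.2⟩ = φ v) → φ = 0) ∧
    (∀ φ : ↥(Vminus p k) →ₗ[k] ↥(St p k),
      (∀ (g : G p) (v : ↥(Vminus p k)),
        φ ⟨gTT p k g (v : StT p k), hstab g v v.2⟩ = gSt p k g (φ v)) → φ = 0) := by
  refine ⟨fun φ hφ => eq_zero_of_B_invariant hstab φ fun b _ => hφ b, fun φ hφ => ?_⟩
  let ev : ↥(St p k) →ₗ[k] k :=
    Finsupp.lapply (QuotientGroup.mk 1 : G p ⧸ B p) ∘ₗ Mmod.toCosets p k ∘ₗ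
      (St p k).subtype.restrictScalars k
  have hev (g : G p) (v : ↥(St p k)) :
      ev (gSt p k g v) = Mmod.toCosets p k v (g⁻¹ • QuotientGroup.mk 1) := by
    rw [← Mmod.toCosets_γ_smul_apply g, smul_inv_smul]
    rfl
  have hzero : ev ∘ₗ φ = 0 := by
    refine eq_zero_of_B_invariant hstab _ fun b hb v => ?_
    have hb' : b⁻¹ • (QuotientGroup.mk 1 : G p ⧸ B p) = QuotientGroup.mk 1 :=
      QuotientGroup.eq.2 (by simpa using hb)
    rw [LinearMap.comp_apply, hφ, hev, hb']
    rfl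
  ext v : 1
  refine Subtype.ext (Mmod.toCosets_injective (Finsupp.ext fun c => ?_))
  obtain ⟨g, rfl⟩ := QuotientGroup.mk_surjective c
  have hg : (QuotientGroup.mk g : G p ⧸ B p) = (g⁻¹)⁻¹ • QuotientGroup.mk 1 := by
    rw [inv_inv, MulAction.Quotient.smul_mk, smul_eq_mul, mul_one]
  rw [hg, ← hev, ← hφ]
  simpa using LinearMap.congr_fun hzero ⟨_, hstab g⁻¹ v v.2⟩

end SL2X
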